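/- Let W be a graphon and let (G_n) be a sequence of weighted graphs with |G_n| = n, β_max = sup_{i,j,n} β_ij(n) < ∞ and G_n → W. Then the expected number of vertices of G_n(1/n) lying in isolated edges (components with exactly 2 vertices) satisfies (1/n)·E(N₂(G_n(1/n))) → ∫₀¹∫₀¹ W(x,y) e^{−λ(x)} e^{−λ(y)} dx dy as n → ∞, where λ(x) = ∫₀¹ W(x,y)dy. -/

import Mathlib

open MeasureTheory Filter Topology

noncomputable section

namespace Percolation

/-- The symmetrized lift of a two-variable real function to `Sym2`. If `f` is symmetric,
`sym2Val f s(a, b) = f a b`. -/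
def sym2Val {α : Type*} (f : α → α → ℝ) : Sym2 α → ℝ :=
  Sym2.lift ⟨fun a b => (f a b + f b a) / 2, fun a b => by simp [add_comm]⟩

/-- The product over the edges of `F` of a symmetric function of the endpoints. -/
def edgeProd {k : ℕ} (F : SimpleGraph (Fin k)) (f : Fin k → Fin k → ℝ) : ℝ := by
  classical exact ∏ e ∈ F.edgeFinset, sym2Val f e

/-- The homomorphism density `t(F, G)` of a finite simple graph `F` in the weighted graph
on `[n]` with edge weights `β`. -/
def homDensityG {n k : ℕ} (β : Fin n → Fin n → ℝ) (F : SimpleGraph (Fin k)) : ℝ :=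
  (∑ v : Fin k → Fin n, edgeProd F fun i j => β (v i) (v j)) / (n : ℝ) ^ k

/-- The unit interval `[0,1] ⊆ ℝ`. -/
def I01 : Set ℝ := Set.Icc 0 1

/-- The homomorphism density `t(F, W)` of a finite simple graph `F` in a graphon `W`. -/
def homDensityW {k : ℕ} (W : ℝ → ℝ → ℝ) (F : SimpleGraph (Fin k)) : ℝ :=
  ∫ x : Fin k → ℝ in Set.univ.pi fun _ => I01, edgeProd F fun i j => W (x i) (x j)

/-- `G_n → W`: convergence of the homomorphism densities for every finite simple graph. -/
def ConvergesTo (β : ∀ n : ℕ, Fin n → Fin n → ℝ) (W : ℝ → ℝ → ℝ) : Prop :=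
  ∀ (k : ℕ) (F : SimpleGraph (Fin k)),
    Tendsto (fun n => homDensityG (β n) F) atTop (nhds (homDensityW W F))

/-- `W` is a graphon: a bounded symmetric measurable function with nonnegative values. -/
def IsGraphon (W : ℝ → ℝ → ℝ) : Prop :=
  Measurable (Function.uncurry W) ∧ (∀ x y, 0 ≤ W x y) ∧ (∀ x y, W x y = W y x) ∧
    ∃ M : ℝ, ∀ x y, W x y ≤ M

/-- The Bernoulli measure on `Bool` with success probability `p`. -/
def bern (p : ℝ) : Measure Bool :=
  ENNReal.ofReal p • Measure.dirac true + ENNReal.ofReal (1 - p) • Measure.dirac false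

/-- The law of the random graph in which each pair `{v, w}` is an edge independently
with probability `min (p * β v w) 1`; a point of the sample space records for each
unordered pair whether it is an edge. -/
def percMeasure {V : Type*} [Fintype V] [DecidableEq V] (β : V → V → ℝ) (p : ℝ) :
    Measure (Sym2 V → Bool) :=
  Measure.pi fun e => bern (min (p * sym2Val β e) 1)

/-- The simple graph determined by a point of the sample space. -/
def graphOf {V : Type*} (ω : Sym2 V → Bool) : SimpleGraph V :=
  SimpleGraph.fromRel fun i j => ω s(i, j)

/-- The number of vertices of the component of `v` in `G`. -/
def compSize {V : Type*} (G : SimpleGraph V) (v : V) : ℕ := {w | G.Reachable v w}.ncard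

/-- The number of vertices of the largest component of `G`. -/
def C1 {V : Type*} [Fintype V] (G : SimpleGraph V) : ℕ :=
  Finset.univ.sup fun v => compSize G v

/-- The number of vertices of the second largest component of `G` (zero if `G` is
connected): the largest value of `min (|C_v|, |C_w|)` over vertices `v`, `w` lying in
distinct components. -/
def C2 {V : Type*} (G : SimpleGraph V) : ℕ :=
  sSup {m | ∃ v w : V, ¬G.Reachable v w ∧ m = min (compSize G v) (compSize G w)}

/-- The operator `T_W` with kernel `W` applied to `f`. -/
def applyT (W : ℝ → ℝ → ℝ) (f : ℝ → ℝ) (x : ℝ) : ℝ := ∫ y in I01, W x y * f y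

/-- The `L²[0,1]` norm of a function. -/
def l2norm (f : ℝ → ℝ) : ℝ := Real.sqrt (∫ x in I01, f x ^ 2)

/-- The `L²`-operator norm `‖T_W‖` of the integral operator with kernel `W`. -/
def opNorm (W : ℝ → ℝ → ℝ) : ℝ :=
  sSup {r | ∃ f : ℝ → ℝ, Measurable f ∧
    MeasureTheory.IntegrableOn (fun x => f x ^ 2) I01 ∧
    l2norm f ≤ 1 ∧ r = l2norm (applyT W f)}

/-- The survival probability `ρ(W)` of the multitype Poisson branching process with
kernel `W`: the supremum of `∫ f` over measurable `f : [0,1] → [0,1]` satisfying the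
functional equation `f(x) = 1 - exp(-∫ W(x,y) f(y) dy)` almost everywhere. -/
def survival (W : ℝ → ℝ → ℝ) : ℝ :=
  sSup {r | ∃ f : ℝ → ℝ, Measurable f ∧ (∀ x, f x ∈ Set.Icc (0 : ℝ) 1) ∧
    (∀ᵐ x ∂volume.restrict I01, f x = 1 - Real.exp (-∫ y in I01, W x y * f y)) ∧
    r = ∫ x in I01, f x}

/-- A graphon `W` is irreducible if there is no measurable `A ⊆ [0,1]` with
`0 < μ(A) < 1` such that `W = 0` a.e. on `A × ([0,1] \ A)`. -/
def Irreducible (W : ℝ → ℝ → ℝ) : Prop :=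
  ¬∃ A : Set ℝ, MeasurableSet A ∧ A ⊆ I01 ∧ 0 < volume A ∧ volume A < 1 ∧
    ∀ᵐ p : ℝ × ℝ, p.1 ∈ A → p.2 ∈ I01 \ A → W p.1 p.2 = 0

end Percolation
namespace Percolation

/-- The number of vertices of `G` lying in components with exactly `k` vertices. -/
def Nk {V : Type*} (G : SimpleGraph V) (k : ℕ) : ℕ := {v | compSize G v = k}.ncard

/-- `λ(x) = ∫₀¹ W(x,y) dy`, the marginal of a graphon. -/
def lambdaW (W : ℝ → ℝ → ℝ) (x : ℝ) : ℝ := ∫ y in I01, W x y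

end Percolation

namespace Percolation

def treeG {m : ℕ} (par : Fin m → Fin (m+1)) : SimpleGraph (Fin (m+1)) :=
  SimpleGraph.fromRel fun a b => ∃ i : Fin m, a = par i ∧ b = i.succ

lemma edgeProd_tree {m : ℕ} (par : Fin m → Fin (m+1)) (hpar : ∀ i, par i < i.succ)
    (f : Fin (m+1) → Fin (m+1) → ℝ) (hf : ∀ a b, f a b = f b a) :
    edgeProd (treeG par) f = ∏ i, f (par i) i.succ := by
  classical
  have himg : (treeG par).edgeFinset = Finset.univ.image (fun i : Fin m => s(par i, i.succ)) := by
    ext e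
    induction e using Sym2.ind with
    | _ a b =>
      rw [SimpleGraph.mem_edgeFinset, SimpleGraph.mem_edgeSet]
      simp only [treeG, SimpleGraph.fromRel_adj, Finset.mem_image, Finset.mem_univ, true_and,
        Sym2.eq_iff]
      constructor
      · rintro ⟨_, ⟨i, rfl, rfl⟩ | ⟨i, rfl, rfl⟩⟩
        · exact ⟨i, Or.inl ⟨rfl, rfl⟩⟩
        · exact ⟨i, Or.inr ⟨rfl, rfl⟩⟩
      · rintro ⟨i, ⟨rfl, rfl⟩ | ⟨rfl, rfl⟩⟩
        · exact ⟨(hpar i).ne, Or.inl ⟨i, rfl, rfl⟩⟩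
        · exact ⟨(hpar i).ne', Or.inr ⟨i, rfl, rfl⟩⟩
  have : edgeProd (treeG par) f = ∏ e ∈ (treeG par).edgeFinset, sym2Val f e := by
    unfold edgeProd
    convert rfl
  rw [this, himg, Finset.prod_image]
  · refine Finset.prod_congr rfl fun i _ => ?_
    simp only [sym2Val, Sym2.lift_mk]
    rw [hf i.succ]; ring
  · intro i _ j _ h
    simp only [Sym2.eq_iff] at h
    rcases h with ⟨_, h⟩ | ⟨h1, h2⟩
    · exact Fin.succ_injective _ h
    · have q1 := hpar i
      have q2 := hpar j
      rw [h1] at q1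
      rw [← h2] at q2
      exact absurd q1 (lt_asymm q2)

def dsPar (k l : ℕ) : Fin (k+l+1) → Fin (k+l+1+1) :=
  Fin.cons 0 (fun i : Fin (k+l) => if (i : ℕ) < k then 0 else 1)

lemma dsPar_lt (k l : ℕ) (i) : dsPar k l i < i.succ := by
  induction i using Fin.cases with
  | zero => simp [dsPar]
  | succ i =>
    simp only [dsPar, Fin.cons_succ]
    split_ifs
    · simp
    · rw [Fin.lt_def]; simp

lemma edgeProd_ds (k l : ℕ) {X : Type*} (W : X → X → ℝ) (hW : ∀ a b, W a b = W b a)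
    (x : Fin (k+l+1+1) → X) :
    edgeProd (treeG (dsPar k l)) (fun i j => W (x i) (x j)) =
      W (x 0) (x 1) * ∏ i : Fin (k+l), W (if (i:ℕ) < k then x 0 else x 1) (x i.succ.succ) := by
  rw [edgeProd_tree _ (dsPar_lt k l) _ (fun a b => hW _ _), Fin.prod_univ_succ]
  simp only [dsPar, Fin.cons_zero, Fin.cons_succ]
  congr 1
  refine Finset.prod_congr rfl fun i _ => ?_
  split_ifs <;> rfl

section gen
variable {X : Type*} [MeasurableSpace X] (μ : Measure X) [IsProbabilityMeasure μ]
  (W : X → X → ℝ) (M : ℝ)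

lemma integral_pi_succ2 {m : ℕ} (f : (Fin (m+1+1) → X) → ℝ) (hf : Measurable f)
    (hb : ∃ C, ∀ x, |f x| ≤ C) :
    ∫ x, f x ∂(Measure.pi fun _ : Fin (m+1+1) => μ) =
      ∫ p : X × X, ∫ z : Fin m → X, f (Fin.cons p.1 (Fin.cons p.2 z)) ∂(Measure.pi fun _ => μ)
        ∂(μ.prod μ) := by
  obtain ⟨C, hC⟩ := hb
  have h1 := (measurePreserving_piFinSuccAbove (fun _ : Fin (m+1+1) => μ) 0).symm
  have h2 := (measurePreserving_piFinSuccAbove (fun _ : Fin (m+1) => μ) 0).symm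
  have e1 : ∀ (r : ℕ) (a : X) (z : Fin r → X),
      (MeasurableEquiv.piFinSuccAbove (fun _ : Fin (r+1) => X) 0).symm (a, z) = Fin.cons a z := by
    intro r a z
    exact Fin.insertNth_zero (α := fun _ : Fin (r+1) => X) a z
  rw [← h1.integral_comp']
  have hint : ∀ {Y : Type _} [MeasurableSpace Y] (ν : Measure Y) [IsProbabilityMeasure ν]
      (g : Y → ℝ), Measurable g → (∀ y, |g y| ≤ C) → Integrable g ν := by
    intro Y _ ν _ g hg hgC
    exact Integrable.of_bound hg.aestronglyMeasurable C (Filter.Eventually.of_forall hgC)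
  have hc : Measurable fun q : X × (X × (Fin m → X)) =>
      (Fin.cons q.1 (Fin.cons q.2.1 q.2.2 : Fin (m+1) → X) : Fin (m+1+1) → X) := by
    rw [measurable_pi_iff]
    intro i
    induction i using Fin.cases with
    | zero => simp only [Fin.cons_zero]; fun_prop
    | succ i =>
      induction i using Fin.cases with
      | zero => simp only [Fin.cons_zero, Fin.cons_succ]; fun_prop
      | succ i => simp only [Fin.cons_succ]; fun_prop
  rw [integral_prod]
  · rw [integral_prod]
    · refine integral_congr_ae (Filter.Eventually.of_forall fun x => ?_)
      dsimp only
      rw [← h2.integral_comp', integral_prod]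
      · simp only [e1]
      · refine Integrable.of_bound (Measurable.aestronglyMeasurable ?_) C
          (Filter.Eventually.of_forall fun y => hC _)
        have hx : Measurable fun q : X × (Fin m → X) => (x, q) := by fun_prop
        have := hf.comp (hc.comp hx)
        convert this using 1
        funext q
        rcases q with ⟨a, z⟩
        simp only [e1, Function.comp]
    · apply hint
      · have : Measurable fun q : (X × X) × (Fin m → X) =>
            f (Fin.cons q.1.1 (Fin.cons q.1.2 q.2)) :=
          hf.comp (hc.comp (by fun_prop : Measurable fun q : (X × X) × (Fin m → X) =>
            (q.1.1, (q.1.2, q.2))))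
        exact this.stronglyMeasurable.integral_prod_right.measurable
      · intro p
        have := norm_integral_le_of_norm_le_const (C := C) (μ := Measure.pi fun _ : Fin m => μ)
          (f := fun z : Fin m → X => f (Fin.cons p.1 (Fin.cons p.2 z)))
          (Filter.Eventually.of_forall fun z => hC _)
        simpa using this
  · apply hint
    · exact hf.comp (MeasurableEquiv.measurable _)
    · intro y; exact hC _

structure Ker {X : Type*} [MeasurableSpace X] (W : X → X → ℝ) (M : ℝ) : Prop where
  hm : Measurable (Function.uncurry W)
  h0 : ∀ x y, 0 ≤ W x y
  hs : ∀ x y, W x y = W y x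
  hM : ∀ x y, W x y ≤ M

def lam (x : X) : ℝ := ∫ y, W x y ∂μ

variable {μ W M}

lemma lam_meas (K : Ker W M) : Measurable (lam μ W) := by
  have := K.hm.stronglyMeasurable.integral_prod_right (ν := μ)
  exact this.measurable

lemma lam_nonneg (K : Ker W M) (x : X) : 0 ≤ lam μ W x := integral_nonneg fun y => K.h0 x y

lemma lam_le (K : Ker W M) (x : X) : lam μ W x ≤ M := by
  have : ‖∫ y, W x y ∂μ‖ ≤ M * μ.real Set.univ := 
    norm_integral_le_of_norm_le_const (Filter.Eventually.of_forall fun z => by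
      rw [Real.norm_of_nonneg (K.h0 _ _)]; exact K.hM _ _)
  simp at this
  exact (le_abs_self _).trans this

lemma ds_integral (K : Ker W M) (k l : ℕ) :
    ∫ x, edgeProd (treeG (dsPar k l)) (fun i j => W (x i) (x j))
      ∂(Measure.pi fun _ : Fin (k+l+1+1) => μ) =
    ∫ p : X × X, W p.1 p.2 * (lam μ W p.1 ^ k * lam μ W p.2 ^ l) ∂(μ.prod μ) := by
  simp only [edgeProd_ds k l W K.hs]
  rw [integral_pi_succ2]
  · refine integral_congr_ae (Filter.Eventually.of_forall fun p => ?_)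
    have h1 : ∀ z : Fin (k+l) → X, (Fin.cons p.1 (Fin.cons p.2 z : Fin (k+l+1) → X) : Fin (k+l+1+1) → X) 1 = p.2 := 
      fun z => rfl
    simp only [Fin.cons_zero, Fin.cons_succ, h1]
    rw [integral_const_mul, integral_fintype_prod_eq_prod
      (f := fun (i : Fin (k+l)) z => W (if (i:ℕ) < k then p.1 else p.2) z), Fin.prod_univ_add]
    simp [lam]
  · refine Measurable.mul ?_ (Finset.measurable_prod _ fun i _ => ?_)
    · exact K.hm.comp (by fun_prop : Measurable fun x : Fin (k+l+1+1) → X => (x 0, x 1))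
    · split_ifs
      · exact K.hm.comp (by fun_prop : Measurable fun x : Fin (k+l+1+1) → X => (x 0, x i.succ.succ))
      · exact K.hm.comp (by fun_prop : Measurable fun x : Fin (k+l+1+1) → X => (x 1, x i.succ.succ))
  · refine ⟨M * M ^ (k+l), fun x => ?_⟩
    rw [abs_of_nonneg (mul_nonneg (K.h0 _ _) (Finset.prod_nonneg fun i _ => K.h0 _ _))]
    have hM0 : 0 ≤ M := (K.h0 (x 0) (x 0)).trans (K.hM _ _)
    refine mul_le_mul (K.hM _ _) ?_ (Finset.prod_nonneg fun i _ => K.h0 _ _) hM0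
    refine (Finset.prod_le_prod (fun i _ => K.h0 _ _) (fun i _ => K.hM _ _)).trans ?_
    simp

def coef (q : ℕ × ℕ) : ℝ := ((-1) ^ q.1 / (q.1.factorial : ℝ)) * ((-1) ^ q.2 / (q.2.factorial : ℝ))

lemma bound_summable (M : ℝ) : Summable fun q : ℕ × ℕ =>
    M * ((|M| ^ q.1 / q.1.factorial) * (|M| ^ q.2 / q.2.factorial)) := by
  apply Summable.mul_left
  exact Summable.mul_of_nonneg (Real.summable_pow_div_factorial |M|)
    (Real.summable_pow_div_factorial |M|) (fun n => by positivity) (fun n => by positivity)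

lemma abs_coef (q : ℕ × ℕ) : |coef q| = 1 / (q.1.factorial : ℝ) * (1 / (q.2.factorial : ℝ)) := by
  simp [coef, abs_mul, abs_div]

lemma term_bound (K : Ker W M) [Nonempty X] (q : ℕ × ℕ) (p : X × X) :
    ‖coef q * (W p.1 p.2 * (lam μ W p.1 ^ q.1 * lam μ W p.2 ^ q.2))‖ ≤
      M * ((|M| ^ q.1 / q.1.factorial) * (|M| ^ q.2 / q.2.factorial)) := by
  have hM0 : 0 ≤ M := (K.h0 p.1 p.2).trans (K.hM _ _)
  have a1 := lam_nonneg (μ := μ) K p.1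
  have a2 := lam_nonneg (μ := μ) K p.2
  have b1 := lam_le (μ := μ) K p.1
  have b2 := lam_le (μ := μ) K p.2
  have c1 := K.h0 p.1 p.2
  have c2 := K.hM p.1 p.2
  rw [norm_mul, Real.norm_eq_abs, abs_coef, Real.norm_of_nonneg (by positivity), abs_of_nonneg hM0]
  calc _ ≤ 1 / (q.1.factorial : ℝ) * (1 / (q.2.factorial : ℝ)) * (M * (M ^ q.1 * M ^ q.2)) := by
        gcongr
    _ = _ := by ring

lemma term_meas (K : Ker W M) (q : ℕ × ℕ) : Measurable fun p : X × X =>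
    coef q * (W p.1 p.2 * (lam μ W p.1 ^ q.1 * lam μ W p.2 ^ q.2)) := by
  have h1 := lam_meas (μ := μ) K
  have h2 : Measurable fun p : X × X => W p.1 p.2 := K.hm
  fun_prop

lemma exp_hasSum (w a b : ℝ) : HasSum (fun q : ℕ × ℕ => coef q * (w * (a ^ q.1 * b ^ q.2)))
    (w * Real.exp (-a) * Real.exp (-b)) := by
  have h : ∀ c : ℝ, HasSum (fun n : ℕ => (-c) ^ n / (n.factorial : ℝ)) (Real.exp (-c)) := by
    intro c
    rw [Real.exp_eq_exp_ℝ]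
    exact NormedSpace.expSeries_div_hasSum_exp (-c)
  have hn : ∀ c : ℝ, Summable fun n : ℕ => ‖(-c) ^ n / (n.factorial : ℝ)‖ := by
    intro c
    exact (Real.summable_pow_div_factorial (-c)).norm
  have := ((h a).mul (h b) (summable_mul_of_summable_norm (hn a) (hn b))).mul_left w
  rw [← mul_assoc] at this
  have he : (fun q : ℕ × ℕ => coef q * (w * (a ^ q.1 * b ^ q.2))) = fun q : ℕ × ℕ =>
      w * ((-a) ^ q.1 / (q.1.factorial : ℝ) * ((-b) ^ q.2 / (q.2.factorial : ℝ))) := by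
    funext q
    simp only [coef]
    rw [neg_pow a, neg_pow b]
    ring
  rw [he]
  exact this

lemma main_hasSum (K : Ker W M) :
    HasSum (fun q : ℕ × ℕ => coef q * 
      ∫ x, edgeProd (treeG (dsPar q.1 q.2)) (fun i j => W (x i) (x j))
      ∂(Measure.pi fun _ : Fin (q.1+q.2+1+1) => μ))
    (∫ x, ∫ y, W x y * Real.exp (-lam μ W x) * Real.exp (-lam μ W y) ∂μ ∂μ) := by
  have : Nonempty X := (inferInstance : (ae μ).NeBot).nonempty
  have hi : ∀ q, Integrable (fun p : X × X => 
      coef q * (W p.1 p.2 * (lam μ W p.1 ^ q.1 * lam μ W p.2 ^ q.2))) (μ.prod μ) := fun q =>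
    Integrable.of_bound (term_meas K q).aestronglyMeasurable _
      (Filter.Eventually.of_forall (term_bound K q))
  have key := hasSum_integral_of_summable_integral_norm hi (by
    refine Summable.of_nonneg_of_le (fun q => integral_nonneg fun p => norm_nonneg _) (fun q => ?_)
      (bound_summable M)
    have := integral_mono (hi q).norm (integrable_const _) (term_bound K q)
    simpa using this)
  simp only [ds_integral K, ← integral_const_mul]
  suffices h : (∫ x, ∫ y, W x y * Real.exp (-lam μ W x) * Real.exp (-lam μ W y) ∂μ ∂μ) = _ by
    rw [h]; exact key
  rw [← integral_prod (f := fun p : X × X => W p.1 p.2 * Real.exp (-lam μ W p.1) * Real.exp (-lam μ W p.2))]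
  · refine integral_congr_ae (Filter.Eventually.of_forall fun p => ?_)
    exact (exp_hasSum _ _ _).tsum_eq.symm
  · refine Integrable.of_bound (Measurable.aestronglyMeasurable ?_) M
      (Filter.Eventually.of_forall fun p => ?_)
    · have h1 := lam_meas (μ := μ) K
      have h2 : Measurable fun p : X × X => W p.1 p.2 := K.hm
      fun_prop
    · have a1 := lam_nonneg (μ := μ) K p.1
      have a2 := lam_nonneg (μ := μ) K p.2
      have c1 := K.h0 p.1 p.2
      have c2 := K.hM p.1 p.2
      rw [Real.norm_of_nonneg (by positivity)]
      have e1 : Real.exp (-lam μ W p.1) ≤ 1 := Real.exp_le_one_iff.2 (by linarith)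
      have e2 : Real.exp (-lam μ W p.2) ≤ 1 := Real.exp_le_one_iff.2 (by linarith)
      calc _ ≤ M * 1 * 1 := by gcongr <;> linarith
        _ = M := by ring

lemma main_bound (K : Ker W M) (q : ℕ × ℕ) : ‖coef q * 
      ∫ x, edgeProd (treeG (dsPar q.1 q.2)) (fun i j => W (x i) (x j))
      ∂(Measure.pi fun _ : Fin (q.1+q.2+1+1) => μ)‖ ≤ 
    M * ((|M| ^ q.1 / q.1.factorial) * (|M| ^ q.2 / q.2.factorial)) := by
  have : Nonempty X := (inferInstance : (ae μ).NeBot).nonempty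
  rw [ds_integral K, ← integral_const_mul]
  have := norm_integral_le_of_norm_le_const (μ := μ.prod μ) 
    (Filter.Eventually.of_forall (term_bound (μ := μ) K q))
  simpa using this

end gen
end Percolation
namespace Percolation

def IsoPair {V : Type*} (G : SimpleGraph V) (v w : V) : Prop :=
  G.Adj v w ∧ ∀ u, u ≠ v → u ≠ w → ¬ G.Adj v u ∧ ¬ G.Adj w u

lemma reach_of_iso {V : Type*} {G : SimpleGraph V} {v w : V} (h : IsoPair G v w) :
    {u | G.Reachable v u} = {v, w} := by
  ext u
  simp only [Set.mem_ofPred_eq, Set.mem_insert_iff, Set.mem_singleton_iff]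
  constructor
  · rintro ⟨p⟩
    have : ∀ {a b : V} (p : G.Walk a b), (a = v ∨ a = w) → (b = v ∨ b = w) := by
      intro a b p
      induction p with
      | nil => exact id
      | @cons x y z hxy p ih =>
        intro hx
        apply ih
        by_contra hy
        push Not at hy
        have := h.2 y hy.1 hy.2
        rcases hx with rfl | rfl
        · exact this.1 hxy
        · exact this.2 hxy
    exact this p (Or.inl rfl)
  · rintro (rfl | rfl)
    · exact SimpleGraph.Reachable.refl _
    · exact h.1.reachable

lemma compSize_two_iff {V : Type*} (G : SimpleGraph V) (v : V) :
    compSize G v = 2 ↔ ∃ w, IsoPair G v w := by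
  constructor
  · intro h
    obtain ⟨x, y, hxy, hS⟩ := Set.ncard_eq_two.1 h
    have hv : v ∈ ({x, y} : Set V) := by rw [← hS]; exact SimpleGraph.Reachable.refl v
    obtain ⟨w, hvw, hS⟩ : ∃ w, v ≠ w ∧ {u | G.Reachable v u} = {v, w} := by
      rcases hv with rfl | hv
      · exact ⟨y, hxy, hS⟩
      · obtain rfl : v = y := hv
        exact ⟨x, hxy.symm, by rw [hS, Set.pair_comm]⟩
    have hr : ∀ u, G.Reachable v u → u = v ∨ u = w := by
      intro u hu
      have : u ∈ ({v, w} : Set V) := by rw [← hS]; exact hu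
      simpa using this
    have hw : G.Reachable v w := by
      have : w ∈ {u | G.Reachable v u} := by rw [hS]; simp
      exact this
    refine ⟨w, ?_, fun u hv hw' => ⟨fun ha => ?_, fun ha => ?_⟩⟩
    · obtain ⟨p⟩ := hw
      cases p with
      | nil => exact absurd rfl hvw
      | @cons _ y _ hy p =>
        rcases hr y hy.reachable with rfl | rfl
        · exact absurd rfl hy.ne
        · exact hy
    · rcases hr u ha.reachable with h | h
      · exact hv h
      · exact hw' h
    · rcases hr u (hw.trans ha.reachable) with h | h
      · exact hv h
      · exact hw' h
  · rintro ⟨w, h⟩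
    rw [compSize, reach_of_iso h]
    exact Set.ncard_pair h.1.ne

lemma iso_unique {V : Type*} {G : SimpleGraph V} {v w w' : V} (h : IsoPair G v w)
    (h' : IsoPair G v w') : w = w' := by
  by_contra hne
  exact (h.2 w' h'.1.ne' (Ne.symm hne)).1 h'.1

open Classical in
lemma Nk_two {n : ℕ} (G : SimpleGraph (Fin n)) :
    (Nk G 2 : ℝ) = ∑ v, ∑ w, if IsoPair G v w then (1:ℝ) else 0 := by
  have h1 : (Nk G 2 : ℝ) = ∑ v, if compSize G v = 2 then (1:ℝ) else 0 := by
    rw [Nk, Finset.sum_boole, Set.ncard_eq_toFinset_card', Set.toFinset_ofPred]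
  rw [h1]
  refine Finset.sum_congr rfl fun v _ => ?_
  simp only [compSize_two_iff]
  by_cases h : ∃ w, IsoPair G v w
  · rw [if_pos h]
    obtain ⟨w, hw⟩ := h
    rw [Finset.sum_eq_single w, if_pos hw]
    · intro b _ hb
      rw [if_neg fun h => hb (iso_unique h hw)]
    · simp
  · rw [if_neg h]
    push Not at h
    simp [h]

open Classical in
/-- allowed states -/
def allowed {n : ℕ} (v w : Fin n) (e : Sym2 (Fin n)) : Set Bool :=
  if e = s(v, w) then {true} else
  if e ∈ (Finset.univ \ {v, w} : Finset (Fin n)).image (fun u => s(v, u)) ∪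
    (Finset.univ \ {v, w} : Finset (Fin n)).image (fun u => s(w, u)) then {false} else Set.univ

lemma iso_event {n : ℕ} {v w : Fin n} (hvw : v ≠ w) :
    {ω : Sym2 (Fin n) → Bool | IsoPair (graphOf ω) v w} = Set.univ.pi (allowed v w) := by
  classical
  ext ω
  have hadj : ∀ a b : Fin n, (graphOf ω).Adj a b ↔ a ≠ b ∧ ω s(a, b) = true := by
    intro a b
    simp only [graphOf, SimpleGraph.fromRel_adj]
    rw [Sym2.eq_swap (a := b)]
    simp
  simp only [Set.mem_ofPred_eq, Set.mem_pi, Set.mem_univ, true_imp_iff, IsoPair, hadj]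
  constructor
  · rintro ⟨⟨_, h1⟩, h2⟩ e
    unfold allowed
    split_ifs with ha hb
    · rw [ha]; exact h1
    · simp only [Finset.mem_union, Finset.mem_image, Finset.mem_sdiff, Finset.mem_univ, true_and,
        Finset.mem_insert, Finset.mem_singleton, not_or] at hb
      rcases hb with ⟨u, ⟨hu1, hu2⟩, rfl⟩ | ⟨u, ⟨hu1, hu2⟩, rfl⟩
      · have := (h2 u hu1 hu2).1
        simpa [Ne.symm hu1] using this
      · have := (h2 u hu1 hu2).2
        simpa [Ne.symm hu2] using this
    · trivial
  · intro h
    refine ⟨⟨hvw, ?_⟩, fun u hu1 hu2 => ?_⟩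
    · simpa [allowed] using h s(v, w)
    · have e1 : s(v, u) ≠ s(v, w) := by
        intro h; simp only [Sym2.eq_iff] at h; tauto
      have e2 : s(w, u) ≠ s(v, w) := by
        intro h; simp only [Sym2.eq_iff] at h; tauto
      have m : u ∈ (Finset.univ \ {v, w} : Finset (Fin n)) := by simp [hu1, hu2]
      have a1 := h s(v, u)
      have a2 := h s(w, u)
      rw [allowed, if_neg e1, if_pos (Finset.mem_union_left _ (Finset.mem_image_of_mem _ m))] at a1
      rw [allowed, if_neg e2, if_pos (Finset.mem_union_right _ (Finset.mem_image_of_mem _ m))] at a2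
      have a1' : ω s(v, u) = false := a1
      have a2' : ω s(w, u) = false := a2
      simp [a1', a2']

lemma bern_prob {p : ℝ} (h0 : 0 ≤ p) (h1 : p ≤ 1) : IsProbabilityMeasure (bern p) := by
  constructor
  simp only [bern, Measure.add_apply, Measure.smul_apply, measure_univ, smul_eq_mul, mul_one]
  rw [← ENNReal.ofReal_add h0 (by linarith)]
  simp

instance bern_fin (p : ℝ) : IsFiniteMeasure (bern p) := by
  constructor
  simp [bern]

lemma bern_true {p : ℝ} (h0 : 0 ≤ p) : (bern p).real {true} = p := by
  simp [Measure.real, bern, h0]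

lemma bern_false {p : ℝ} (h1 : p ≤ 1) : (bern p).real {false} = 1 - p := by
  simp [Measure.real, bern, h1]

lemma iso_prob {n : ℕ} (β : Fin n → Fin n → ℝ) (p : ℝ) (hs : ∀ i j, β i j = β j i)
    (h0 : ∀ i j, 0 ≤ p * β i j) (h1 : ∀ i j, p * β i j ≤ 1) {v w : Fin n} (hvw : v ≠ w) :
    (percMeasure β p).real {ω | IsoPair (graphOf ω) v w} =
      p * β v w * ∏ u ∈ (Finset.univ \ {v, w} : Finset (Fin n)),
        ((1 - p * β v u) * (1 - p * β w u)) := by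
  classical
  set U := (Finset.univ \ {v, w} : Finset (Fin n)) with hU
  have hmemU : ∀ u, u ∈ U ↔ u ≠ v ∧ u ≠ w := by intro u; simp [hU]
  have hval : ∀ a b, min (p * sym2Val β s(a, b)) 1 = p * β a b := by
    intro a b
    simp only [sym2Val, Sym2.lift_mk]
    rw [hs b a, add_self_div_two, min_eq_left (h1 a b)]
  rw [iso_event hvw, percMeasure, Measure.real, Measure.pi_pi, ENNReal.toReal_prod]
  set A := U.image (fun u => s(v, u)) with hA
  set B := U.image (fun u => s(w, u)) with hB
  have hnot : s(v, w) ∉ A ∪ B := by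
    simp only [hA, hB, Finset.mem_union, Finset.mem_image, hmemU, Sym2.eq_iff]
    rintro (⟨u, ⟨h1, h2⟩, h⟩ | ⟨u, ⟨h1, h2⟩, h⟩) <;> tauto
  have hdisj : Disjoint A B := by
    rw [Finset.disjoint_left]
    simp only [hA, hB, Finset.mem_image, hmemU]
    rintro e ⟨u, ⟨h1, h2⟩, rfl⟩ ⟨u', ⟨h1', h2'⟩, h⟩
    simp only [Sym2.eq_iff] at h
    rcases h with ⟨h, _⟩ | ⟨h, h'⟩
    · exact hvw h.symm
    · exact h2 h.symm
  rw [← Finset.prod_subset (Finset.subset_univ (insert s(v, w) (A ∪ B))), Finset.prod_insert hnot,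
    Finset.prod_union hdisj, Finset.prod_mul_distrib]
  · have i1 : ∏ x ∈ A, ((bern (min (p * sym2Val β x) 1)) (allowed v w x)).toReal =
        ∏ u ∈ U, (1 - p * β v u) := by
      rw [hA, Finset.prod_image]
      · refine Finset.prod_congr rfl fun u hu => ?_
        have m : s(v, u) ∈ A ∪ B := Finset.mem_union_left _ (Finset.mem_image_of_mem _ hu)
        have hne : s(v, u) ≠ s(v, w) := by intro h; rw [h] at m; exact hnot m
        rw [allowed, if_neg hne, if_pos m, hval]
        exact bern_false (h1 _ _)
      · intro a _ b _ h
        exact Sym2.congr_right.1 h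
    have i2 : ∏ x ∈ B, ((bern (min (p * sym2Val β x) 1)) (allowed v w x)).toReal =
        ∏ u ∈ U, (1 - p * β w u) := by
      rw [hB, Finset.prod_image]
      · refine Finset.prod_congr rfl fun u hu => ?_
        have m : s(w, u) ∈ A ∪ B := Finset.mem_union_right _ (Finset.mem_image_of_mem _ hu)
        have hne : s(w, u) ≠ s(v, w) := by intro h; rw [h] at m; exact hnot m
        rw [allowed, if_neg hne, if_pos m, hval]
        exact bern_false (h1 _ _)
      · intro a _ b _ h
        exact Sym2.congr_right.1 h
    rw [i1, i2, allowed, if_pos rfl, hval]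
    congr 1
    exact bern_true (h0 _ _)
  · intro e _ he
    rw [Finset.mem_insert, not_or] at he
    rw [allowed, if_neg he.1, if_neg he.2]
    induction e using Sym2.ind with
    | _ a b =>
      rw [hval]
      have := bern_prob (h0 a b) (h1 a b)
      rw [measure_univ]
      simp

lemma exp_Nk {n : ℕ} (β : Fin n → Fin n → ℝ) (p : ℝ) (hs : ∀ i j, β i j = β j i)
    (hd : ∀ i, β i i = 0)
    (h0 : ∀ i j, 0 ≤ p * β i j) (h1 : ∀ i j, p * β i j ≤ 1) :
    ∫ ω, (Nk (graphOf ω) 2 : ℝ) ∂percMeasure β p =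
      ∑ v, ∑ w, p * β v w * ∏ u ∈ (Finset.univ \ {v, w} : Finset (Fin n)),
        ((1 - p * β v u) * (1 - p * β w u)) := by
  classical
  have : IsFiniteMeasure (percMeasure β p) := by
    unfold percMeasure; infer_instance
  simp only [Nk_two]
  rw [integral_finsetSum _ (fun _ _ => Integrable.of_finite)]
  refine Finset.sum_congr rfl fun v _ => ?_
  rw [integral_finsetSum _ (fun _ _ => Integrable.of_finite)]
  refine Finset.sum_congr rfl fun w _ => ?_
  by_cases hvw : v = w
  · subst hvw
    simp [hd, IsoPair]
  rw [← iso_prob β p hs h0 h1 hvw, ← integral_indicator_one (Set.toFinite _).measurableSet]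
  refine integral_congr_ae (Filter.Eventually.of_forall fun ω => ?_)
  simp [Set.indicator_apply]

/-! analytic estimate -/

lemma prod_diff {ι : Type*} (s : Finset ι) (a b : ι → ℝ) (ha : ∀ i, a i ∈ Set.Icc (0:ℝ) 1)
    (hb : ∀ i, b i ∈ Set.Icc (0:ℝ) 1) : |∏ i ∈ s, a i - ∏ i ∈ s, b i| ≤ ∑ i ∈ s, |a i - b i| := by
  classical
  induction s using Finset.induction_on with
  | empty => simp
  | insert i s hi ih =>
    rw [Finset.prod_insert hi, Finset.prod_insert hi, Finset.sum_insert hi]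
    have hA0 : 0 ≤ ∏ i ∈ s, a i := Finset.prod_nonneg fun i _ => (ha i).1
    have hA1 : ∏ i ∈ s, a i ≤ 1 := Finset.prod_le_one (fun i _ => (ha i).1) fun i _ => (ha i).2
    have e : a i * ∏ i ∈ s, a i - b i * ∏ i ∈ s, b i =
      (a i - b i) * ∏ i ∈ s, a i + b i * (∏ i ∈ s, a i - ∏ i ∈ s, b i) := by ring
    rw [e]
    refine (abs_add_le _ _).trans (add_le_add ?_ ?_)
    · rw [abs_mul, abs_of_nonneg hA0]
      exact mul_le_of_le_one_right (abs_nonneg _) hA1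
    · rw [abs_mul, abs_of_nonneg (hb i).1]
      exact (mul_le_of_le_one_left (abs_nonneg _) (hb i).2).trans ih

lemma one_sub_exp {p : ℝ} (h0 : 0 ≤ p) (h1 : p ≤ 1) : |(1 - p) - Real.exp (-p)| ≤ p ^ 2 := by
  have := Real.abs_exp_sub_one_sub_id_le (x := -p) (by rwa [abs_neg, abs_of_nonneg h0])
  rw [abs_sub_comm]
  have e : Real.exp (-p) - 1 - -p = Real.exp (-p) - (1 - p) := by ring
  rw [e] at this
  simpa using this

lemma prod_est {n : ℕ} (P : Fin n → Fin n → ℝ) (hd : ∀ i, P i i = 0)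
    (ε : ℝ) (h0 : ∀ i j, 0 ≤ P i j) (hε : ∀ i j, P i j ≤ ε) (hε1 : ε ≤ 1) (v w : Fin n) :
    |∏ u ∈ (Finset.univ \ {v, w} : Finset (Fin n)), ((1 - P v u) * (1 - P w u)) -
      Real.exp (-∑ u, P v u) * Real.exp (-∑ u, P w u)| ≤ n * (2 * ε ^ 2) + 2 * ε := by
  classical
  have hε0 : 0 ≤ ε := (h0 v w).trans (hε v w)
  have hexp : ∀ i j, Real.exp (-P i j) ∈ Set.Icc (0:ℝ) 1 := fun i j =>
    ⟨(Real.exp_pos _).le, Real.exp_le_one_iff.2 (by linarith [h0 i j])⟩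
  have hone : ∀ i j, 1 - P i j ∈ Set.Icc (0:ℝ) 1 := fun i j =>
    ⟨by linarith [hε i j], by linarith [h0 i j]⟩
  have hmul : ∀ x y : ℝ, x ∈ Set.Icc (0:ℝ) 1 → y ∈ Set.Icc (0:ℝ) 1 → x * y ∈ Set.Icc (0:ℝ) 1 :=
    fun x y hx hy => ⟨mul_nonneg hx.1 hy.1, mul_le_one₀ hx.2 hy.1 hy.2⟩
  let a : Fin n → ℝ := fun u => if u ∈ ({v, w} : Finset (Fin n)) then 1 else
    (1 - P v u) * (1 - P w u)
  let b : Fin n → ℝ := fun u => Real.exp (-P v u) * Real.exp (-P w u)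
  have ea : ∏ u ∈ (Finset.univ \ {v, w} : Finset (Fin n)), ((1 - P v u) * (1 - P w u)) =
      ∏ u, a u := by
    rw [← Finset.prod_subset (Finset.subset_univ (Finset.univ \ {v, w} : Finset (Fin n)))]
    · refine Finset.prod_congr rfl fun u hu => ?_
      rw [Finset.mem_sdiff] at hu
      simp only [a]
      rw [if_neg hu.2]
    · intro u _ hu
      have : u ∈ ({v, w} : Finset (Fin n)) := by
        by_contra h
        exact hu (Finset.mem_sdiff.2 ⟨Finset.mem_univ _, h⟩)
      simp only [a]
      rw [if_pos this]
  have eb : Real.exp (-∑ u, P v u) * Real.exp (-∑ u, P w u) = ∏ u, b u := by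
    simp only [b]
    rw [Finset.prod_mul_distrib, ← Real.exp_sum, ← Real.exp_sum, Finset.sum_neg_distrib,
      Finset.sum_neg_distrib]
  rw [ea, eb]
  refine (prod_diff _ a b ?_ ?_).trans ?_
  · intro u
    simp only [a]
    split_ifs
    · simp
    · exact hmul _ _ (hone _ _) (hone _ _)
  · intro u
    exact hmul _ _ (hexp _ _) (hexp _ _)
  have hsq : ∀ i j, |(1 - P i j) - Real.exp (-P i j)| ≤ ε ^ 2 := fun i j =>
    (one_sub_exp (h0 i j) ((hε i j).trans hε1)).trans
      (pow_le_pow_left₀ (h0 i j) (hε i j) 2)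
  have hlin : ∀ i j, |1 - Real.exp (-P i j)| ≤ ε := fun i j => by
    rw [abs_of_nonneg (by linarith [(hexp i j).2])]
    linarith [Real.add_one_le_exp (-P i j), hε i j]
  calc ∑ u, |a u - b u| ≤ ∑ u, (2 * ε ^ 2 + if u ∈ ({v, w} : Finset (Fin n)) then ε else 0) := by
        refine Finset.sum_le_sum fun u _ => ?_
        by_cases hu : u ∈ ({v, w} : Finset (Fin n))
        · simp only [a, b, if_pos hu]
          have : |1 - Real.exp (-P v u) * Real.exp (-P w u)| ≤ ε := by
            rcases Finset.mem_insert.1 hu with rfl | hu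
            · simpa [hd] using hlin w u
            · rw [Finset.mem_singleton] at hu
              subst hu
              simpa [hd] using hlin v u
          nlinarith [sq_nonneg ε]
        · simp only [a, b, if_neg hu, add_zero]
          have e : (1 - P v u) * (1 - P w u) - Real.exp (-P v u) * Real.exp (-P w u) =
            ((1 - P v u) - Real.exp (-P v u)) * (1 - P w u) +
            Real.exp (-P v u) * ((1 - P w u) - Real.exp (-P w u)) := by ring
          rw [e, two_mul]
          refine (abs_add_le _ _).trans (add_le_add ?_ ?_)
          · rw [abs_mul, abs_of_nonneg (hone w u).1]
            exact (mul_le_of_le_one_right (abs_nonneg _) (hone w u).2).trans (hsq _ _)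
          · rw [abs_mul, abs_of_nonneg (hexp v u).1]
            exact (mul_le_of_le_one_left (abs_nonneg _) (hexp v u).2).trans (hsq _ _)
    _ ≤ n * (2 * ε ^ 2) + 2 * ε := by
        rw [Finset.sum_add_distrib, Finset.sum_ite_mem, Finset.univ_inter]
        simp only [Finset.sum_const, nsmul_eq_mul, Finset.card_univ, Fintype.card_fin]
        have : (({v, w} : Finset (Fin n)).card : ℝ) ≤ 2 := by exact_mod_cast Finset.card_le_two
        gcongr

end Percolation
namespace Percolation

def unif (n : ℕ) : Measure (Fin n) := (n : ENNReal)⁻¹ • Measure.count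

lemma unif_prob {n : ℕ} (hn : n ≠ 0) : IsProbabilityMeasure (unif n) := by
  constructor
  simp only [unif, Measure.smul_apply, Measure.count_univ, smul_eq_mul]
  simp only [ENat.card_eq_coe_fintype_card, Fintype.card_fin, ENat.toENNReal_coe]
  exact ENNReal.inv_mul_cancel (by exact_mod_cast hn) (ENNReal.natCast_ne_top n)

lemma unif_singleton {n : ℕ} (v : Fin n) : unif n {v} = (n : ENNReal)⁻¹ := by
  simp [unif]

lemma unif_integral {n : ℕ} (hn : n ≠ 0) (f : Fin n → ℝ) :
    ∫ v, f v ∂(unif n) = (∑ v, f v) / n := by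
  have := unif_prob hn
  rw [integral_fintype Integrable.of_finite, Finset.sum_div]
  refine Finset.sum_congr rfl fun v _ => ?_
  rw [Measure.real, unif_singleton]
  simp [div_eq_inv_mul]

lemma homG_eq {n k : ℕ} (hn : n ≠ 0) (β : Fin n → Fin n → ℝ) (F : SimpleGraph (Fin k)) :
    homDensityG β F = ∫ x, edgeProd F (fun i j => β (x i) (x j))
      ∂(Measure.pi fun _ : Fin k => unif n) := by
  have := unif_prob hn
  rw [integral_fintype Integrable.of_finite, homDensityG, Finset.sum_div]
  refine Finset.sum_congr rfl fun v _ => ?_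
  rw [Measure.real, Measure.pi_singleton]
  simp [unif_singleton, div_eq_inv_mul]

lemma I01_prob : IsProbabilityMeasure (volume.restrict I01) := by
  constructor
  simp [I01]

lemma homW_eq {k : ℕ} (W : ℝ → ℝ → ℝ) (F : SimpleGraph (Fin k)) :
    homDensityW W F = ∫ x, edgeProd F (fun i j => W (x i) (x j))
      ∂(Measure.pi fun _ : Fin k => volume.restrict I01) := by
  rw [homDensityW, volume_pi, Measure.restrict_pi_pi]

lemma smooth_tendsto (β : ∀ n : ℕ, Fin n → Fin n → ℝ) (βmax : ℝ)
    (hsym : ∀ n i j, β n i j = β n j i)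
    (hnonneg : ∀ n i j, 0 ≤ β n i j)
    (hbound : ∀ n i j, β n i j ≤ βmax)
    (W : ℝ → ℝ → ℝ) (hW : IsGraphon W) (hconv : ConvergesTo β W) :
    Tendsto
      (fun n : ℕ => ∫ x, ∫ y, β n x y * Real.exp (-lam (unif n) (β n) x) *
        Real.exp (-lam (unif n) (β n) y) ∂(unif n) ∂(unif n))
      atTop
      (nhds (∫ x in I01, ∫ y in I01,
        W x y * Real.exp (-lambdaW W x) * Real.exp (-lambdaW W y))) := by
  obtain ⟨hm, h0, hs, M, hM⟩ := hW
  have K : Ker W M := ⟨hm, h0, hs, hM⟩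
  have Kn : ∀ n, Ker (β n) βmax := fun n => ⟨measurable_of_finite _, hnonneg n, hsym n, hbound n⟩
  have := I01_prob
  have hLim := (main_hasSum (μ := volume.restrict I01) K).tsum_eq
  have key : Tendsto (fun n => ∑' q : ℕ × ℕ, coef q * homDensityG (β n) (treeG (dsPar q.1 q.2)))
      atTop (nhds (∑' q : ℕ × ℕ, coef q * homDensityW W (treeG (dsPar q.1 q.2)))) := by
    refine tendsto_tsum_of_dominated_convergence (bound_summable βmax)
      (fun q => (hconv _ _).const_mul _) ?_
    filter_upwards [eventually_ne_atTop 0] with n hn q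
    have := unif_prob hn
    rw [homG_eq hn]
    exact main_bound (Kn n) q
  simp only [homW_eq] at key
  rw [hLim] at key
  refine key.congr' ?_
  filter_upwards [eventually_ne_atTop 0] with n hn
  have := unif_prob hn
  simp only [homG_eq hn]
  exact (main_hasSum (Kn n)).tsum_eq

lemma exp_close {n : ℕ} (hn : n ≠ 0) (β : Fin n → Fin n → ℝ) (M : ℝ)
    (hs : ∀ i j, β i j = β j i) (h0 : ∀ i j, 0 ≤ β i j) (hd : ∀ i, β i i = 0)
    (hM : ∀ i j, β i j ≤ M) (hMn : M ≤ n) :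
    |(∫ ω, (Nk (graphOf ω) 2 : ℝ) ∂percMeasure β (1 / n)) / n -
      ∫ x, ∫ y, β x y * Real.exp (-lam (unif n) β x) *
        Real.exp (-lam (unif n) β y) ∂(unif n) ∂(unif n)| ≤ M * (2 * M ^ 2 + 2 * M) / n := by
  have hn0 : (0:ℝ) < n := by exact_mod_cast Nat.pos_of_ne_zero hn
  have hM0 : 0 ≤ M := (h0 ⟨0, Nat.pos_of_ne_zero hn⟩ ⟨0, Nat.pos_of_ne_zero hn⟩).trans (hM _ _)
  have p0 : ∀ i j, 0 ≤ 1 / (n:ℝ) * β i j := fun i j => mul_nonneg (by positivity) (h0 i j)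
  have pε : ∀ i j, 1 / (n:ℝ) * β i j ≤ M / n := fun i j => by
    rw [one_div, ← div_eq_inv_mul]; gcongr; exact hM i j
  have hε1 : M / n ≤ 1 := (div_le_one hn0).2 hMn
  rw [exp_Nk β (1 / n) hs hd p0 fun i j => (pε i j).trans hε1]
  have hl : ∀ v, lam (unif n) β v = ∑ u, 1 / (n:ℝ) * β v u := by
    intro v
    rw [lam, unif_integral hn, ← Finset.mul_sum]
    ring
  simp only [unif_integral hn, hl]
  rw [← sub_div, ← Finset.sum_sub_distrib, abs_div, abs_of_pos hn0]
  gcongr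
  have hterm : ∀ v : Fin n, |(∑ w, 1 / (n:ℝ) * β v w * ∏ u ∈ (Finset.univ \ {v, w} : Finset (Fin n)),
        ((1 - 1 / (n:ℝ) * β v u) * (1 - 1 / (n:ℝ) * β w u))) -
      (∑ w, β v w * Real.exp (-∑ u, 1 / (n:ℝ) * β v u) * Real.exp (-∑ u, 1 / (n:ℝ) * β w u)) / n| ≤
      M * (2 * M ^ 2 + 2 * M) / n := by
    intro v
    rw [Finset.sum_div, ← Finset.sum_sub_distrib]
    refine (Finset.abs_sum_le_sum_abs _ _).trans ?_
    have : ∀ w ∈ (Finset.univ : Finset (Fin n)), |1 / (n:ℝ) * β v w * ∏ u ∈ (Finset.univ \ {v, w} : Finset (Fin n)),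
        ((1 - 1 / (n:ℝ) * β v u) * (1 - 1 / (n:ℝ) * β w u)) -
      β v w * Real.exp (-∑ u, 1 / (n:ℝ) * β v u) * Real.exp (-∑ u, 1 / (n:ℝ) * β w u) / n| ≤
      M / n * (n * (2 * (M / n) ^ 2) + 2 * (M / n)) := by
      intro w _
      have e := prod_est (fun i j => 1 / (n:ℝ) * β i j) (by simp [hd]) (M / n) p0 pε hε1 v w
      rw [show β v w * Real.exp (-∑ u, 1 / (n:ℝ) * β v u) * Real.exp (-∑ u, 1 / (n:ℝ) * β w u) / n =
        1 / (n:ℝ) * β v w * (Real.exp (-∑ u, 1 / (n:ℝ) * β v u) * Real.exp (-∑ u, 1 / (n:ℝ) * β w u)) by ring,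
        ← mul_sub, abs_mul, abs_of_nonneg (p0 v w)]
      exact mul_le_mul (pε v w) e (abs_nonneg _) (by positivity)
    refine (Finset.sum_le_sum this).trans (le_of_eq ?_)
    simp only [Finset.sum_const, nsmul_eq_mul, Finset.card_univ, Fintype.card_fin]
    field_simp
  refine (Finset.abs_sum_le_sum_abs _ _).trans ((Finset.sum_le_sum fun v _ => hterm v).trans (le_of_eq ?_))
  simp only [Finset.sum_const, nsmul_eq_mul, Finset.card_univ, Fintype.card_fin]
  field_simp

end Percolation

open Percolation MeasureTheory Filter Topology in
/-- If `(G_n)` converges to a graphon `W`, then the expected number of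
vertices of `G_n(1/n)` in isolated edges satisfies
`E(N₂)/n → ∫₀¹∫₀¹ W(x,y) e^{-λ(x)} e^{-λ(y)} dx dy`. -/
theorem expected_isolated_edges
    (β : ∀ n : ℕ, Fin n → Fin n → ℝ) (βmax : ℝ)
    (hsym : ∀ n i j, β n i j = β n j i)
    (hnonneg : ∀ n i j, 0 ≤ β n i j)
    (hdiag : ∀ n i, β n i i = 0)
    (hbound : ∀ n i j, β n i j ≤ βmax)
    (W : ℝ → ℝ → ℝ) (hW : IsGraphon W) (hconv : ConvergesTo β W) :
    Tendsto
      (fun n : ℕ =>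
        (∫ ω, (Nk (graphOf ω) 2 : ℝ) ∂percMeasure (β n) (1 / n)) / n)
      atTop
      (nhds (∫ x in I01, ∫ y in I01,
        W x y * Real.exp (-lambdaW W x) * Real.exp (-lambdaW W y))) := by
  have h1 := smooth_tendsto β βmax hsym hnonneg hbound W hW hconv
  have h2 : Tendsto (fun n : ℕ => (∫ ω, (Nk (graphOf ω) 2 : ℝ) ∂percMeasure (β n) (1 / n)) / n -
      ∫ x, ∫ y, β n x y * Real.exp (-lam (unif n) (β n) x) *
        Real.exp (-lam (unif n) (β n) y) ∂(unif n) ∂(unif n)) atTop (nhds 0) := by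
    refine squeeze_zero_norm' ?_
      (tendsto_const_div_atTop_nhds_zero_nat (βmax * (2 * βmax ^ 2 + 2 * βmax)))
    filter_upwards [eventually_ne_atTop 0, eventually_ge_atTop ⌈βmax⌉₊] with n hn hn2
    exact exp_close hn (β n) βmax (hsym n) (hnonneg n) (hdiag n) (hbound n) (Nat.ceil_le.1 hn2)
  have h3 := h2.add h1
  rw [zero_add] at h3
  refine h3.congr fun n => ?_
  ring
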